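/- Let Ω ⊂ ℝⁿ be a bounded open set, let f : Ω × ℝ × ℝⁿ → ℝ be measurable, and let g be a bounded Lipschitz function on Ω. Suppose w ∈ A(g,Ω), V is an open set compactly contained in Ω, and h ∈ W^{1,∞}(V) ∩ C(V̄) satisfies h = w on ∂V and F(h,V) ≤ F(w,V). Then the glued function w̃ defined by w̃ = h on V and w̃ = w on Ω \ V belongs to A(g,Ω), i.e. w̃ is again a minimizer of F(·,Ω) over W_g^{1,∞}(Ω). -/

import Mathlib

open MeasureTheory Filter Set

/-- The supremal functional `F(u,V) = ess sup_{x ∈ V} f(x, u(x), Du(x))`, valued in `EReal`. -/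
noncomputable def suprF {n : ℕ} (f : EuclideanSpace ℝ (Fin n) → ℝ → EuclideanSpace ℝ (Fin n) → ℝ)
    (u : EuclideanSpace ℝ (Fin n) → ℝ) (V : Set (EuclideanSpace ℝ (Fin n))) : EReal :=
  essSup (fun x => ((f x (u x) (gradient u x) : ℝ) : EReal)) (volume.restrict V)

/-- Hypothesis (H1): lower semicontinuity in `(s,p)` for a.e. `x ∈ Ω`, and
quasiconvexity (level-convexity) of `p ↦ f x s p` for all `(x,s)`. -/
def H1 {n : ℕ} (Ω : Set (EuclideanSpace ℝ (Fin n)))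
    (f : EuclideanSpace ℝ (Fin n) → ℝ → EuclideanSpace ℝ (Fin n) → ℝ) : Prop :=
  (∀ᵐ x ∂(volume.restrict Ω),
      LowerSemicontinuous (fun sp : ℝ × EuclideanSpace ℝ (Fin n) => f x sp.1 sp.2)) ∧
  (∀ x ∈ Ω, ∀ s : ℝ, ∀ p q : EuclideanSpace ℝ (Fin n), ∀ t : ℝ, 0 ≤ t → t ≤ 1 →
      f x s (t • p + (1 - t) • q) ≤ max (f x s p) (f x s q))

/-- Hypothesis (H2): uniform coercivity. -/
def H2 {n : ℕ} (Ω : Set (EuclideanSpace ℝ (Fin n)))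
    (f : EuclideanSpace ℝ (Fin n) → ℝ → EuclideanSpace ℝ (Fin n) → ℝ) : Prop :=
  ∀ c : ℝ, ∃ R : ℝ, 0 ≤ R ∧ ∀ x ∈ Ω, ∀ s : ℝ, ∀ p : EuclideanSpace ℝ (Fin n),
    f x s p ≤ c → ‖p‖ ≤ R

/-- `u` is a bounded Lipschitz function on `V` (i.e. `u ∈ W^{1,∞}(V)`). -/
def BddLipschitzOn {n : ℕ} (u : EuclideanSpace ℝ (Fin n) → ℝ)
    (V : Set (EuclideanSpace ℝ (Fin n))) : Prop :=
  (∃ K : NNReal, LipschitzOnWith K u V) ∧ ∃ M : ℝ, ∀ x ∈ V, |u x| ≤ M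

/-- `u` is locally Lipschitz on `Ω`. -/
def LocLipschitzOn {n : ℕ} (u : EuclideanSpace ℝ (Fin n) → ℝ)
    (Ω : Set (EuclideanSpace ℝ (Fin n))) : Prop :=
  ∀ x ∈ Ω, ∃ s ∈ nhds x, ∃ K : NNReal, LipschitzOnWith K u s

/-- The Dirichlet class `W_g^{1,∞}(Ω)`: bounded Lipschitz functions `u` on `Ω` such that
`u - g` extends continuously by zero to the boundary `∂Ω`. -/
def DirichletClass {n : ℕ} (Ω : Set (EuclideanSpace ℝ (Fin n)))
    (g u : EuclideanSpace ℝ (Fin n) → ℝ) : Prop :=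
  BddLipschitzOn u Ω ∧
  ∀ x ∈ frontier Ω, Tendsto (fun y => u y - g y) (nhdsWithin x Ω) (nhds 0)

/-- `u ∈ A(g,Ω)`: `u` minimizes `F(·,Ω)` over `W_g^{1,∞}(Ω)`. -/
def Minimizes {n : ℕ} (f : EuclideanSpace ℝ (Fin n) → ℝ → EuclideanSpace ℝ (Fin n) → ℝ)
    (Ω : Set (EuclideanSpace ℝ (Fin n))) (g u : EuclideanSpace ℝ (Fin n) → ℝ) : Prop :=
  DirichletClass Ω g u ∧ ∀ v, DirichletClass Ω g v → suprF f u Ω ≤ suprF f v Ω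

/-- `u` is an absolute superminimizer of `F` on `Ω`. -/
def AbsSuper {n : ℕ} (f : EuclideanSpace ℝ (Fin n) → ℝ → EuclideanSpace ℝ (Fin n) → ℝ)
    (Ω : Set (EuclideanSpace ℝ (Fin n))) (u : EuclideanSpace ℝ (Fin n) → ℝ) : Prop :=
  ∀ V : Set (EuclideanSpace ℝ (Fin n)), IsOpen V → IsCompact (closure V) → closure V ⊆ Ω →
    ∀ v : EuclideanSpace ℝ (Fin n) → ℝ,
      (∃ K : NNReal, LipschitzOnWith K v V) → ContinuousOn v (closure V) →
      (∀ x ∈ V, u x < v x) → (∀ x ∈ frontier V, v x = u x) →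
      suprF f u V ≤ suprF f v V

/-- `u` is an absolute subminimizer of `F` on `Ω`. -/
def AbsSub {n : ℕ} (f : EuclideanSpace ℝ (Fin n) → ℝ → EuclideanSpace ℝ (Fin n) → ℝ)
    (Ω : Set (EuclideanSpace ℝ (Fin n))) (u : EuclideanSpace ℝ (Fin n) → ℝ) : Prop :=
  ∀ V : Set (EuclideanSpace ℝ (Fin n)), IsOpen V → IsCompact (closure V) → closure V ⊆ Ω →
    ∀ v : EuclideanSpace ℝ (Fin n) → ℝ,
      (∃ K : NNReal, LipschitzOnWith K v V) → ContinuousOn v (closure V) →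
      (∀ x ∈ V, v x < u x) → (∀ x ∈ frontier V, v x = u x) →
      suprF f u V ≤ suprF f v V

/-- `u` is an absolute minimizer of `F` on `Ω`: `F(v,V) ≥ F(u,V)` for every `V ⊂⊂ Ω` and every
`v ∈ W^{1,∞}(V) ∩ C(V̄)` with `v = u` on `∂V`. -/
def AbsMin {n : ℕ} (f : EuclideanSpace ℝ (Fin n) → ℝ → EuclideanSpace ℝ (Fin n) → ℝ)
    (Ω : Set (EuclideanSpace ℝ (Fin n))) (u : EuclideanSpace ℝ (Fin n) → ℝ) : Prop :=
  ∀ V : Set (EuclideanSpace ℝ (Fin n)), IsOpen V → IsCompact (closure V) → closure V ⊆ Ω →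
    ∀ v : EuclideanSpace ℝ (Fin n) → ℝ,
      (∃ K : NNReal, LipschitzOnWith K v V) → ContinuousOn v (closure V) →
      (∀ x ∈ frontier V, v x = u x) →
      suprF f u V ≤ suprF f v V

/-- Two real functions which agree on a measurable set `s` and are differentiable at almost every
point of `s` have the same derivative at almost every point of `s`. -/
theorem ae_restrict_fderiv_eq_of_eqOn {E : Type*} [NormedAddCommGroup E] [NormedSpace ℝ E]
    [FiniteDimensional ℝ E] [MeasurableSpace E] [BorelSpace E] (μ : Measure E) [μ.IsAddHaarMeasure]
    {s : Set E} (hs : MeasurableSet s) {u v : E → ℝ} (huv : EqOn u v s)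
    (hu : ∀ᵐ x ∂μ.restrict s, DifferentiableAt ℝ u x)
    (hv : ∀ᵐ x ∂μ.restrict s, DifferentiableAt ℝ v x) :
    ∀ᵐ x ∂μ.restrict s, fderiv ℝ u x = fderiv ℝ v x := by
  rcases subsingleton_or_nontrivial E with hE | hE
  · exact ae_of_all _ fun x => ContinuousLinearMap.ext fun y => by
      rw [Subsingleton.elim y 0, map_zero, map_zero]
  obtain ⟨e, he⟩ := exists_ne (0 : E)
  set t := s ∩ ({x | DifferentiableAt ℝ u x} ∩ {x | DifferentiableAt ℝ v x})
  have htm : MeasurableSet t := hs.inter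
    ((measurableSet_of_differentiableAt ℝ u).inter (measurableSet_of_differentiableAt ℝ v))
  have happ : ApproximatesLinearOn (fun x => (u x - v x) • e) (0 : E →L[ℝ] E) t 0 := by
    intro x hx y hy
    simp [huv hx.1, huv hy.1]
  have key := happ.norm_fderiv_sub_le μ htm
    (fun x => (fderiv ℝ u x - fderiv ℝ v x).smulRight e) fun x hx =>
      ((hx.2.1.hasFDerivAt.sub hx.2.2.hasFDerivAt).smul_const e).hasFDerivWithinAt
  rw [ae_restrict_iff' htm] at key
  rw [ae_restrict_iff' hs] at hu hv ⊢
  filter_upwards [key, hu, hv] with x hx hxu hxv hxs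
  have h0 := hx ⟨hxs, hxu hxs, hxv hxs⟩
  rw [sub_zero, nonpos_iff_eq_zero, nnnorm_eq_zero] at h0
  ext y
  have h1 := DFunLike.congr_fun h0 y
  simpa [he, sub_eq_zero] using h1

/-- A segment joining a point of `V` to a point outside `V` meets the frontier of `V`. -/
theorem exists_mem_segment_frontier {E : Type*} [NormedAddCommGroup E] [NormedSpace ℝ E]
    {V : Set E} {x y : E} (hx : x ∈ V) (hy : y ∉ V) : ∃ z ∈ segment ℝ x y, z ∈ frontier V := by
  by_contra! hcon
  have hpre := (convex_segment (𝕜 := ℝ) x y).isPreconnected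
  have hcover : segment ℝ x y ⊆ interior V ∪ (closure V)ᶜ := fun z hz => by
    by_contra hn
    rw [mem_union, not_or, notMem_compl_iff] at hn
    exact hcon z hz ⟨hn.2, hn.1⟩
  have hxi : x ∈ interior V := (hcover (left_mem_segment ℝ x y)).resolve_right
    fun hc => hc (subset_closure hx)
  have hyc : y ∈ (closure V)ᶜ := (hcover (right_mem_segment ℝ x y)).resolve_left
    fun hc => hy (interior_subset hc)
  obtain ⟨z, -, hzi, hzc⟩ := hpre _ _ isOpen_interior isClosed_closure.isOpen_compl hcover
    ⟨x, left_mem_segment ℝ x y, hxi⟩ ⟨y, right_mem_segment ℝ x y, hyc⟩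
  exact hzc (subset_closure (interior_subset hzi))

open Classical in
/-- Gluing two functions which are Lipschitz on `V` and on `Ω ⊇ closure V`, and agree on the
frontier of `V`, yields a Lipschitz function on `Ω`. -/
theorem LipschitzOnWith.glue {E : Type*} [NormedAddCommGroup E] [NormedSpace ℝ E] {V Ω : Set E}
    {h w : E → ℝ} {K L : NNReal} (hVΩ : closure V ⊆ Ω) (hh : LipschitzOnWith K h (closure V))
    (hw : LipschitzOnWith L w Ω) (hbd : ∀ x ∈ frontier V, h x = w x) :
    LipschitzOnWith (max K L) (fun x => if x ∈ V then h x else w x) Ω := by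
  have hK : (K : ℝ) ≤ max (K : ℝ) L := le_max_left _ _
  have hL : (L : ℝ) ≤ max (K : ℝ) L := le_max_right _ _
  have cross : ∀ x ∈ V, ∀ y ∈ Ω, y ∉ V → dist (h x) (w y) ≤ max (K : ℝ) L * dist x y := by
    intro x hx y hy hyV
    obtain ⟨z, hz, hzV⟩ := exists_mem_segment_frontier hx hyV
    have hzc := frontier_subset_closure hzV
    calc dist (h x) (w y) ≤ dist (h x) (h z) + dist (w z) (w y) := by
          rw [hbd z hzV]; exact dist_triangle _ _ _
      _ ≤ K * dist x z + L * dist z y :=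
          add_le_add (hh.dist_le_mul x (subset_closure hx) z hzc)
            (hw.dist_le_mul z (hVΩ hzc) y hy)
      _ ≤ max (K : ℝ) L * dist x z + max (K : ℝ) L * dist z y := by gcongr
      _ = max (K : ℝ) L * dist x y := by rw [← mul_add, dist_add_dist_of_mem_segment hz]
  refine LipschitzOnWith.of_dist_le_mul fun x hx y hy => ?_
  rw [NNReal.coe_max]
  by_cases hxV : x ∈ V <;> by_cases hyV : y ∈ V <;> simp only [hxV, hyV, if_true, if_false]
  · exact (hh.dist_le_mul x (subset_closure hxV) y (subset_closure hyV)).trans (by gcongr)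
  · exact cross x hxV y hy hyV
  · rw [dist_comm, dist_comm x]
    exact cross y hyV x hx hxV
  · exact (hw.dist_le_mul x hx y hy).trans (by gcongr)

/-- Rademacher's theorem on an open set. -/
theorem LipschitzOnWith.ae_restrict_differentiableAt {E : Type*} [NormedAddCommGroup E]
    [NormedSpace ℝ E] [FiniteDimensional ℝ E] [MeasurableSpace E] [BorelSpace E] (μ : Measure E)
    [μ.IsAddHaarMeasure] {s : Set E} (hs : IsOpen s) {u : E → ℝ} {K : NNReal}
    (hu : LipschitzOnWith K u s) : ∀ᵐ x ∂μ.restrict s, DifferentiableAt ℝ u x := by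
  filter_upwards [hu.ae_differentiableWithinAt hs.measurableSet,
    ae_restrict_mem hs.measurableSet] with x hx hxs
  exact hx.differentiableAt (hs.mem_nhds hxs)

open Classical in
/-- Gluing does not increase the supremal functional beyond its values on the two pieces. -/
theorem suprF_glue_le {n : ℕ} {Ω V : Set (EuclideanSpace ℝ (Fin n))}
    (f : EuclideanSpace ℝ (Fin n) → ℝ → EuclideanSpace ℝ (Fin n) → ℝ)
    {h w : EuclideanSpace ℝ (Fin n) → ℝ} {K L : NNReal} (hΩo : IsOpen Ω) (hVo : IsOpen V)
    (hw : LipschitzOnWith L w Ω)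
    (hglue : LipschitzOnWith K (fun x => if x ∈ V then h x else w x) Ω) :
    suprF f (fun x => if x ∈ V then h x else w x) Ω ≤ max (suprF f h V) (suprF f w Ω) := by
  have hm : MeasurableSet (Ω \ V) := hΩo.measurableSet.diff hVo.measurableSet
  have hgrad := ae_restrict_fderiv_eq_of_eqOn volume hm
    (u := fun x => if x ∈ V then h x else w x) (v := w) (fun x hx => if_neg hx.2)
    (ae_restrict_of_ae_restrict_of_subset sdiff_subset (hglue.ae_restrict_differentiableAt _ hΩo))
    (ae_restrict_of_ae_restrict_of_subset sdiff_subset (hw.ae_restrict_differentiableAt _ hΩo))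
  have hV : ∀ᵐ x ∂volume.restrict V, ((f x (h x) (gradient h x) : ℝ) : EReal) ≤ suprF f h V :=
    ae_le_essSup
  have hΩ : ∀ᵐ x ∂volume.restrict Ω, ((f x (w x) (gradient w x) : ℝ) : EReal) ≤ suprF f w Ω :=
    ae_le_essSup
  refine essSup_le_of_ae_le _ ?_
  rw [ae_restrict_iff' hm] at hgrad
  rw [ae_restrict_iff' hVo.measurableSet] at hV
  rw [ae_restrict_iff' hΩo.measurableSet] at hΩ
  rw [EventuallyLE, ae_restrict_iff' hΩo.measurableSet]
  filter_upwards [hgrad, hV, hΩ] with x hxg hxV hxΩ hx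
  by_cases hmem : x ∈ V
  · have hev : (fun y => if y ∈ V then h y else w y) =ᶠ[nhds x] h := by
      filter_upwards [hVo.mem_nhds hmem] with y hy using if_pos hy
    rw [hev.gradient_eq, if_pos hmem]
    exact (hxV hmem).trans (le_max_left _ _)
  · rw [gradient, hxg ⟨hx, hmem⟩, if_neg hmem]
    exact (hxΩ hx).trans (le_max_right _ _)

open Classical in
/-- Gluing in a set compactly contained in `Ω` preserves the Dirichlet class. -/
theorem DirichletClass.glue {n : ℕ} {Ω V : Set (EuclideanSpace ℝ (Fin n))}
    {g h w : EuclideanSpace ℝ (Fin n) → ℝ} {K : NNReal} (hw : DirichletClass Ω g w)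
    (hΩo : IsOpen Ω) (hVc : IsCompact (closure V)) (hVΩ : closure V ⊆ Ω)
    (hhC : ContinuousOn h (closure V))
    (hglue : LipschitzOnWith K (fun x => if x ∈ V then h x else w x) Ω) :
    DirichletClass Ω g (fun x => if x ∈ V then h x else w x) := by
  obtain ⟨⟨-, M, hM⟩, hlim⟩ := hw
  obtain ⟨N, hN⟩ := hVc.exists_bound_of_continuousOn hhC
  refine ⟨⟨⟨K, hglue⟩, max N M, fun x hx => ?_⟩, fun x hx => (hlim x hx).congr' ?_⟩
  · dsimp only
    split_ifs with hxV
    · exact (hN x (subset_closure hxV)).trans (le_max_left _ _)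
    · exact (hM x hx).trans (le_max_right _ _)
  · have hxV : x ∉ closure V := fun hc => by
      rw [hΩo.frontier_eq] at hx
      exact hx.2 (hVΩ hc)
    filter_upwards [mem_nhdsWithin_of_mem_nhds (isClosed_closure.isOpen_compl.mem_nhds hxV)]
      with y hy
    rw [if_neg fun hyV => hy (subset_closure hyV)]

/- STATEMENT 14: gluing a minimizer `w ∈ A(g,Ω)` with a competitor `h` on `V ⊂⊂ Ω` satisfying
`h = w` on `∂V` and `F(h,V) ≤ F(w,V)` yields again a minimizer in `A(g,Ω)`. -/
open Classical in
theorem stmt14 {n : ℕ} (Ω : Set (EuclideanSpace ℝ (Fin n)))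
    (hΩo : IsOpen Ω) (hΩb : Bornology.IsBounded Ω)
    (f : EuclideanSpace ℝ (Fin n) → ℝ → EuclideanSpace ℝ (Fin n) → ℝ)
    (hfm : Measurable (fun q : EuclideanSpace ℝ (Fin n) × ℝ × EuclideanSpace ℝ (Fin n) =>
      f q.1 q.2.1 q.2.2))
    (g : EuclideanSpace ℝ (Fin n) → ℝ) (hg : BddLipschitzOn g Ω)
    (w : EuclideanSpace ℝ (Fin n) → ℝ) (hw : Minimizes f Ω g w)
    (V : Set (EuclideanSpace ℝ (Fin n)))
    (hVo : IsOpen V) (hVc : IsCompact (closure V)) (hVΩ : closure V ⊆ Ω)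
    (h : EuclideanSpace ℝ (Fin n) → ℝ)
    (hhLip : ∃ K : NNReal, LipschitzOnWith K h V) (hhC : ContinuousOn h (closure V))
    (hbd : ∀ x ∈ frontier V, h x = w x)
    (hle : suprF f h V ≤ suprF f w V) :
    Minimizes f Ω g (fun x => if x ∈ V then h x else w x) := by
  obtain ⟨K, hK⟩ := hhLip
  obtain ⟨L, hL⟩ := hw.1.1.1
  have hglue := LipschitzOnWith.glue hVΩ (hK.closure hhC) hL hbd
  refine ⟨hw.1.glue hΩo hVc hVΩ hhC hglue, fun v hv => ?_⟩
  have hmono : suprF f w V ≤ suprF f w Ω :=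
    essSup_mono_measure' (Measure.restrict_mono (subset_closure.trans hVΩ) le_rfl)
  exact (suprF_glue_le f hΩo hVo hL hglue).trans
    ((max_le (hle.trans hmono) le_rfl).trans (hw.2 v hv))
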